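/- arXiv:2208.13889 — 11 statements merged into one kernel-verified Lean document; each statement's English description precedes it below -/
import Mathlib

section
/- Let L be a tense DLI⁺-algebra. Then x ⊓ F y ≤ F(P x ⊓ y) and x ⊓ P y ≤ P(F x ⊓ y); moreover F x ⊓ y = ⊥ if and only if x ⊓ P y = ⊥. -/
/-- A DLI-algebra: a bounded distributive lattice with an implication
satisfying (I1)-(I4). -/
structure DLI (A : Type*) [DistribLattice A] [BoundedOrder A] where
  imp : A → A → A
  I1 : ∀ a b d : A, imp a b ⊓ imp a d = imp a (b ⊓ d)
  I2 : ∀ a b d : A, imp a d ⊓ imp b d = imp (a ⊔ b) d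
  I3 : ∀ a : A, imp ⊥ a = ⊤
  I4 : ∀ a : A, imp a ⊤ = ⊤

/-- A tense DLI⁺-algebra: a DLI-algebra satisfying (I5), with tense operators
G, H, F, P satisfying (T1)-(T6). -/
structure TenseDLIp (A : Type*) [DistribLattice A] [BoundedOrder A] extends DLI A where
  I5 : ∀ a b : A, a ⊓ imp a b ≤ b
  G : A → A
  H : A → A
  F : A → A
  P : A → A
  T1 : ∀ x y : A, P x ≤ y ↔ x ≤ G y
  T2 : ∀ x y : A, F x ≤ y ↔ x ≤ H y
  T3G : ∀ x y : A, G x ⊓ F y ≤ F (x ⊓ y)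
  T3H : ∀ x y : A, H x ⊓ P y ≤ P (x ⊓ y)
  T4G : ∀ x y : A, G (x ⊔ y) ≤ G x ⊔ F y
  T4H : ∀ x y : A, H (x ⊔ y) ≤ H x ⊔ P y
  T5G : ∀ x y : A, G (imp x y) ≤ imp (G x) (G y)
  T5H : ∀ x y : A, H (imp x y) ≤ imp (H x) (H y)
  T6G : ∀ x y : A, G (imp x y) ≤ imp (F x) (F y)
  T6H : ∀ x y : A, H (imp x y) ≤ imp (P x) (P y)

/-- Properties (T15) and (T16) of tense DLI⁺-algebras. -/
theorem stmt2 {A : Type*} [DistribLattice A] [BoundedOrder A] (L : TenseDLIp A) :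
    (∀ x y : A, x ⊓ L.F y ≤ L.F (L.P x ⊓ y)) ∧
    (∀ x y : A, x ⊓ L.P y ≤ L.P (L.F x ⊓ y)) ∧
    (∀ x y : A, L.F x ⊓ y = ⊥ ↔ x ⊓ L.P y = ⊥) := by
  have hF : ∀ x y : A, x ⊓ L.F y ≤ L.F (L.P x ⊓ y) := fun x y =>
    (inf_le_inf_right _ ((L.T1 x _).1 le_rfl)).trans (L.T3G _ y)
  have hP : ∀ x y : A, x ⊓ L.P y ≤ L.P (L.F x ⊓ y) := fun x y =>
    (inf_le_inf_right _ ((L.T2 x _).1 le_rfl)).trans (L.T3H _ y)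
  refine ⟨hF, hP, fun x y => ⟨fun h => ?_, fun h => ?_⟩⟩
  · have hxy := hP x y
    rw [h] at hxy
    exact le_bot_iff.1 (hxy.trans ((L.T1 _ _).2 bot_le))
  · have hyx := hF y x
    rw [inf_comm (L.P y), h, inf_comm] at hyx
    exact le_bot_iff.1 (hyx.trans ((L.T2 _ _).2 bot_le))
end

section
/- Let L be a tense DLI⁺-algebra. Then G(x ⊔ H y) ≤ G x ⊔ y and H(x ⊔ G y) ≤ H x ⊔ y; moreover x ⊔ H y = ⊤ if and only if G x ⊔ y = ⊤. -/
/-- Properties (T17) and (T18) of tense DLI⁺-algebras. -/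
theorem stmt3 {A : Type*} [DistribLattice A] [BoundedOrder A] (L : TenseDLIp A) :
    (∀ x y : A, L.G (x ⊔ L.H y) ≤ L.G x ⊔ y) ∧
    (∀ x y : A, L.H (x ⊔ L.G y) ≤ L.H x ⊔ y) ∧
    (∀ x y : A, x ⊔ L.H y = ⊤ ↔ L.G x ⊔ y = ⊤) := by
  have hG (x y : A) : L.G (x ⊔ L.H y) ≤ L.G x ⊔ y :=
    (L.T4G x (L.H y)).trans (sup_le_sup_left ((L.T2 _ _).2 le_rfl) _)
  have hH (x y : A) : L.H (x ⊔ L.G y) ≤ L.H x ⊔ y :=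
    (L.T4H x (L.G y)).trans (sup_le_sup_left ((L.T1 _ _).2 le_rfl) _)
  refine ⟨hG, hH, fun x y => ⟨fun h => ?_, fun h => ?_⟩⟩
  · have h₁ := hG x y
    rw [h] at h₁
    exact top_le_iff.1 (((L.T1 _ _).1 le_top).trans h₁)
  · have h₁ := hH y x
    rw [sup_comm y, h, sup_comm _ x] at h₁
    exact top_le_iff.1 (((L.T2 _ _).1 le_top).trans h₁)
end

section
/- Let U be a tense centered KI-algebra. Then: (c1) F c = c and P c = c; (c2) G(x ⊔ c) = G x ⊔ c and H(x ⊔ c) = H x ⊔ c; (c3) F(x ⊓ c) = F x ⊓ c and P(x ⊓ c) = P x ⊓ c. -/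
/-- A tense KI-algebra: a centered Kleene algebra with an implication ⇒
satisfying (KI1)-(KI5), together with tense operators G, H satisfying
(t1)-(t6), where F x := ∼G(∼x) and P x := ∼H(∼x). -/
structure TenseKI (T : Type*) [DistribLattice T] [BoundedOrder T] where
  neg : T → T
  c : T
  imp : T → T → T
  neg_neg : ∀ x : T, neg (neg x) = x
  neg_sup : ∀ x y : T, neg (x ⊔ y) = neg x ⊓ neg y
  kleene : ∀ x y : T, x ⊓ neg x ≤ y ⊔ neg y
  neg_c : neg c = c
  KI1a : ∀ x y z : T, imp x y ⊓ imp x z = imp x (y ⊓ z)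
  KI1b : ∀ x y z : T, imp x z ⊓ imp y z = imp (x ⊔ y) z
  KI1c : ∀ x : T, imp ⊥ x = ⊤
  KI1d : ∀ x : T, imp x ⊤ = ⊤
  KI2 : ∀ x y : T, (x ⊓ imp x y) ⊔ c ≤ y ⊔ c
  KI3 : imp c c = ⊤
  KI4 : ∀ x y : T, imp x y ⊓ c = (neg x ⊔ y) ⊓ c
  KI5 : ∀ x y : T, imp x (neg y) ⊔ c = imp x (neg y ⊔ c) ⊓ imp y (neg x ⊔ c)
  G : T → T
  H : T → T
  t1G : G ⊤ = ⊤
  t1H : H ⊤ = ⊤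
  t2G : ∀ x y : T, G (x ⊓ y) = G x ⊓ G y
  t2H : ∀ x y : T, H (x ⊓ y) = H x ⊓ H y
  t3G : ∀ x : T, x ≤ G (neg (H (neg x)))
  t3H : ∀ x : T, x ≤ H (neg (G (neg x)))
  t4G : ∀ x y : T, G (x ⊔ y) ≤ G x ⊔ neg (G (neg y))
  t4H : ∀ x y : T, H (x ⊔ y) ≤ H x ⊔ neg (H (neg y))
  t5G : ∀ x y : T, G (imp x y) ≤ imp (G x) (G y)
  t5H : ∀ x y : T, H (imp x y) ≤ imp (H x) (H y)
  t6G : ∀ x y : T, G (imp x y) ≤ imp (neg (G (neg x))) (neg (G (neg y)))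
  t6H : ∀ x y : T, H (imp x y) ≤ imp (neg (H (neg x))) (neg (H (neg y)))

/-- F x := ∼G(∼x). -/
def TenseKI.F {T : Type*} [DistribLattice T] [BoundedOrder T] (K : TenseKI T) (x : T) : T :=
  K.neg (K.G (K.neg x))

/-- P x := ∼H(∼x). -/
def TenseKI.P {T : Type*} [DistribLattice T] [BoundedOrder T] (K : TenseKI T) (x : T) : T :=
  K.neg (K.H (K.neg x))

namespace TenseKI

variable {T : Type*} [DistribLattice T] [BoundedOrder T] (K : TenseKI T)

theorem neg_inf (x y : T) : K.neg (x ⊓ y) = K.neg x ⊔ K.neg y := by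
  rw [← K.neg_neg (K.neg x ⊔ K.neg y), K.neg_sup, K.neg_neg, K.neg_neg]

theorem F_c (hGc : K.G K.c = K.c) : K.F K.c = K.c := by
  rw [F, K.neg_c, hGc, K.neg_c]

theorem P_c (hHc : K.H K.c = K.c) : K.P K.c = K.c := by
  rw [P, K.neg_c, hHc, K.neg_c]

theorem G_mono : Monotone K.G := fun x y h => by
  rw [← inf_eq_left, ← K.t2G, inf_eq_left.mpr h]

theorem H_mono : Monotone K.H := fun x y h => by
  rw [← inf_eq_left, ← K.t2H, inf_eq_left.mpr h]

theorem G_sup_c (hGc : K.G K.c = K.c) (x : T) : K.G (x ⊔ K.c) = K.G x ⊔ K.c := by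
  apply le_antisymm
  · simpa only [K.neg_c, hGc] using K.t4G x K.c
  · simpa only [hGc] using K.G_mono.le_map_sup x K.c

theorem H_sup_c (hHc : K.H K.c = K.c) (x : T) : K.H (x ⊔ K.c) = K.H x ⊔ K.c := by
  apply le_antisymm
  · simpa only [K.neg_c, hHc] using K.t4H x K.c
  · simpa only [hHc] using K.H_mono.le_map_sup x K.c

theorem F_inf_c (hGc : K.G K.c = K.c) (x : T) : K.F (x ⊓ K.c) = K.F x ⊓ K.c := by
  rw [F, F, K.neg_inf, K.neg_c, K.G_sup_c hGc, K.neg_sup, K.neg_c]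

theorem P_inf_c (hHc : K.H K.c = K.c) (x : T) : K.P (x ⊓ K.c) = K.P x ⊓ K.c := by
  rw [P, P, K.neg_inf, K.neg_c, K.H_sup_c hHc, K.neg_sup, K.neg_c]

end TenseKI

/-- Properties (c1), (c2), (c3) of tense centered KI-algebras. -/
theorem stmt4 {T : Type*} [DistribLattice T] [BoundedOrder T] (K : TenseKI T)
    (hGc : K.G K.c = K.c) (hHc : K.H K.c = K.c) :
    K.F K.c = K.c ∧ K.P K.c = K.c ∧
    (∀ x : T, K.G (x ⊔ K.c) = K.G x ⊔ K.c) ∧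
    (∀ x : T, K.H (x ⊔ K.c) = K.H x ⊔ K.c) ∧
    (∀ x : T, K.F (x ⊓ K.c) = K.F x ⊓ K.c) ∧
    (∀ x : T, K.P (x ⊓ K.c) = K.P x ⊓ K.c) :=
  ⟨K.F_c hGc, K.P_c hHc, K.G_sup_c hGc, K.H_sup_c hHc, K.F_inf_c hGc, K.P_inf_c hHc⟩
end

section
/- Let L be a tense DLI⁺-algebra and let a, b ∈ A with a ⊓ b = ⊥. Then G a ⊓ F b = ⊥, H a ⊓ P b = ⊥, F a ⊓ G b = ⊥, and P a ⊓ H b = ⊥ (so the operators G_K(a,b) = (G a, F b), H_K(a,b) = (H a, P b), F_K(a,b) = (F a, G b), P_K(a,b) = (P a, H b) map K(A) into K(A)); moreover F_K(a,b) = ∼G_K(∼(a,b)) and P_K(a,b) = ∼H_K(∼(a,b)), where ∼(a,b) = (b,a). -/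
section Kalman

variable {A : Type*} [DistribLattice A] [BoundedOrder A]

/-- ∼(a,b) = (b,a) on the Kalman construction. -/
def negK (p : A × A) : A × A := (p.2, p.1)

/-- (a,b) ⊔ (x,y) = (a ⊔ x, b ⊓ y). -/
def supK (p q : A × A) : A × A := (p.1 ⊔ q.1, p.2 ⊓ q.2)

/-- (a,b) ⊓ (x,y) = (a ⊓ x, b ⊔ y). -/
def infK (p q : A × A) : A × A := (p.1 ⊓ q.1, p.2 ⊔ q.2)

/-- (a,b) ⇒ (x,y) = ((a→x) ⊓ (y→b), a ⊓ y). -/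
def impK (L : TenseDLIp A) (p q : A × A) : A × A :=
  (L.imp p.1 q.1 ⊓ L.imp q.2 p.2, p.1 ⊓ q.2)

/-- The order of the Kalman construction: (a,b) ≤ (x,y) iff a ≤ x and y ≤ b. -/
def leK (p q : A × A) : Prop := p.1 ≤ q.1 ∧ q.2 ≤ p.2

/-- G_K(a,b) = (G a, F b). -/
def GK (L : TenseDLIp A) (p : A × A) : A × A := (L.G p.1, L.F p.2)

/-- H_K(a,b) = (H a, P b). -/
def HK (L : TenseDLIp A) (p : A × A) : A × A := (L.H p.1, L.P p.2)

/-- F_K(a,b) = (F a, G b). -/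
def FK (L : TenseDLIp A) (p : A × A) : A × A := (L.F p.1, L.G p.2)

/-- P_K(a,b) = (P a, H b). -/
def PK (L : TenseDLIp A) (p : A × A) : A × A := (L.P p.1, L.H p.2)

end Kalman

namespace TenseDLIp

variable {A : Type*} [DistribLattice A] [BoundedOrder A] (L : TenseDLIp A)

theorem F_bot : L.F ⊥ = ⊥ := le_bot_iff.mp ((L.T2 _ _).mpr bot_le)

theorem P_bot : L.P ⊥ = ⊥ := le_bot_iff.mp ((L.T1 _ _).mpr bot_le)

theorem G_inf_F_eq_bot {a b : A} (hab : a ⊓ b = ⊥) : L.G a ⊓ L.F b = ⊥ :=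
  le_bot_iff.mp ((L.T3G a b).trans_eq (by rw [hab, L.F_bot]))

theorem H_inf_P_eq_bot {a b : A} (hab : a ⊓ b = ⊥) : L.H a ⊓ L.P b = ⊥ :=
  le_bot_iff.mp ((L.T3H a b).trans_eq (by rw [hab, L.P_bot]))

end TenseDLIp

/-- Lemma: the operators G_K, H_K, F_K, P_K map K(A) into K(A), and
F_K = ∼ ∘ G_K ∘ ∼, P_K = ∼ ∘ H_K ∘ ∼. -/
theorem stmt5 {A : Type*} [DistribLattice A] [BoundedOrder A] (L : TenseDLIp A)
    (a b : A) (hab : a ⊓ b = ⊥) :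
    L.G a ⊓ L.F b = ⊥ ∧ L.H a ⊓ L.P b = ⊥ ∧
    L.F a ⊓ L.G b = ⊥ ∧ L.P a ⊓ L.H b = ⊥ ∧
    FK L (a, b) = negK (GK L (negK (a, b))) ∧
    PK L (a, b) = negK (HK L (negK (a, b))) := by
  have hba : b ⊓ a = ⊥ := by rw [inf_comm, hab]
  refine ⟨L.G_inf_F_eq_bot hab, L.H_inf_P_eq_bot hab, ?_, ?_, rfl, rfl⟩
  · rw [inf_comm, L.G_inf_F_eq_bot hba]
  · rw [inf_comm, L.H_inf_P_eq_bot hba]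
end

section
/- Let L be a tense DLI⁺-algebra. Then on K(A), ordered by (a,b) ≤ (x,y) iff a ≤ x and y ≤ b, the operators G_K(a,b) = (G a, F b), H_K(a,b) = (H a, P b) satisfy (with F_K(a,b) = (F a, G b) and P_K(a,b) = (P a, H b)): (t1) G_K(⊤,⊥) = (⊤,⊥) and H_K(⊤,⊥) = (⊤,⊥); (t2) G_K((a,b)⊓(x,y)) = G_K(a,b) ⊓ G_K(x,y) and H_K((a,b)⊓(x,y)) = H_K(a,b) ⊓ H_K(x,y); (t3) (a,b) ≤ G_K(P_K(a,b)) and (a,b) ≤ H_K(F_K(a,b)); (t4) G_K((a,b)⊔(x,y)) ≤ G_K(a,b) ⊔ F_K(x,y) and H_K((a,b)⊔(x,y)) ≤ H_K(a,b) ⊔ P_K(x,y); (t5) G_K((a,b)⇒(x,y)) ≤ G_K(a,b) ⇒ G_K(x,y) and H_K((a,b)⇒(x,y)) ≤ H_K(a,b) ⇒ H_K(x,y); (t6) G_K((a,b)⇒(x,y)) ≤ F_K(a,b) ⇒ F_K(x,y) and H_K((a,b)⇒(x,y)) ≤ P_K(a,b) ⇒ P_K(x,y). Moreover, if G ⊥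 = ⊥ and H ⊥ = ⊥, then G_K(⊥,⊥) = (⊥,⊥) and H_K(⊥,⊥) = (⊥,⊥). -/
namespace TenseDLIp

variable {A : Type*} [DistribLattice A] [BoundedOrder A] (L : TenseDLIp A)

theorem gc_P_G : GaloisConnection L.P L.G := L.T1

theorem gc_F_H : GaloisConnection L.F L.H := L.T2

theorem G_imp_inf_imp_le_G_F (a b x y : A) :
    L.G (L.imp a x ⊓ L.imp y b) ≤ L.imp (L.G a) (L.G x) ⊓ L.imp (L.F y) (L.F b) :=
  L.gc_P_G.u_inf.trans_le (inf_le_inf (L.T5G a x) (L.T6G y b))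

theorem H_imp_inf_imp_le_H_P (a b x y : A) :
    L.H (L.imp a x ⊓ L.imp y b) ≤ L.imp (L.H a) (L.H x) ⊓ L.imp (L.P y) (L.P b) :=
  L.gc_F_H.u_inf.trans_le (inf_le_inf (L.T5H a x) (L.T6H y b))

theorem G_imp_inf_imp_le_F_G (a b x y : A) :
    L.G (L.imp a x ⊓ L.imp y b) ≤ L.imp (L.F a) (L.F x) ⊓ L.imp (L.G y) (L.G b) :=
  L.gc_P_G.u_inf.trans_le (inf_le_inf (L.T6G a x) (L.T5G y b))

theorem H_imp_inf_imp_le_P_H (a b x y : A) :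
    L.H (L.imp a x ⊓ L.imp y b) ≤ L.imp (L.P a) (L.P x) ⊓ L.imp (L.H y) (L.H b) :=
  L.gc_F_H.u_inf.trans_le (inf_le_inf (L.T6H a x) (L.T5H y b))

theorem F_inf_G_le (x y : A) : L.F x ⊓ L.G y ≤ L.F (x ⊓ y) := by
  simpa only [inf_comm] using L.T3G y x

theorem P_inf_H_le (x y : A) : L.P x ⊓ L.H y ≤ L.P (x ⊓ y) := by
  simpa only [inf_comm] using L.T3H y x

end TenseDLIp

/-- The Kalman construction of a tense DLI⁺-algebra satisfies the axioms
(t1)-(t6) of tense KI-algebras; moreover, if G⊥ = ⊥ and H⊥ = ⊥, then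
G_K and H_K fix the center (⊥,⊥). -/
theorem stmt6 {A : Type*} [DistribLattice A] [BoundedOrder A] (L : TenseDLIp A) :
    (GK L ((⊤ : A), (⊥ : A)) = ((⊤ : A), (⊥ : A))) ∧
    (HK L ((⊤ : A), (⊥ : A)) = ((⊤ : A), (⊥ : A))) ∧
    (∀ a b x y : A, a ⊓ b = ⊥ → x ⊓ y = ⊥ →
      GK L (infK (a, b) (x, y)) = infK (GK L (a, b)) (GK L (x, y))) ∧
    (∀ a b x y : A, a ⊓ b = ⊥ → x ⊓ y = ⊥ →
      HK L (infK (a, b) (x, y)) = infK (HK L (a, b)) (HK L (x, y))) ∧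
    (∀ a b : A, a ⊓ b = ⊥ → leK (a, b) (GK L (PK L (a, b)))) ∧
    (∀ a b : A, a ⊓ b = ⊥ → leK (a, b) (HK L (FK L (a, b)))) ∧
    (∀ a b x y : A, a ⊓ b = ⊥ → x ⊓ y = ⊥ →
      leK (GK L (supK (a, b) (x, y))) (supK (GK L (a, b)) (FK L (x, y)))) ∧
    (∀ a b x y : A, a ⊓ b = ⊥ → x ⊓ y = ⊥ →
      leK (HK L (supK (a, b) (x, y))) (supK (HK L (a, b)) (PK L (x, y)))) ∧
    (∀ a b x y : A, a ⊓ b = ⊥ → x ⊓ y = ⊥ →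
      leK (GK L (impK L (a, b) (x, y))) (impK L (GK L (a, b)) (GK L (x, y)))) ∧
    (∀ a b x y : A, a ⊓ b = ⊥ → x ⊓ y = ⊥ →
      leK (HK L (impK L (a, b) (x, y))) (impK L (HK L (a, b)) (HK L (x, y)))) ∧
    (∀ a b x y : A, a ⊓ b = ⊥ → x ⊓ y = ⊥ →
      leK (GK L (impK L (a, b) (x, y))) (impK L (FK L (a, b)) (FK L (x, y)))) ∧
    (∀ a b x y : A, a ⊓ b = ⊥ → x ⊓ y = ⊥ →
      leK (HK L (impK L (a, b) (x, y))) (impK L (PK L (a, b)) (PK L (x, y)))) ∧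
    (L.G ⊥ = ⊥ → L.H ⊥ = ⊥ →
      GK L ((⊥ : A), (⊥ : A)) = ((⊥ : A), (⊥ : A)) ∧
      HK L ((⊥ : A), (⊥ : A)) = ((⊥ : A), (⊥ : A))) := by
  have hPG := L.gc_P_G
  have hFH := L.gc_F_H
  exact ⟨Prod.ext hPG.u_top hFH.l_bot, Prod.ext hFH.u_top hPG.l_bot,
    fun _ _ _ _ _ _ => Prod.ext hPG.u_inf hFH.l_sup,
    fun _ _ _ _ _ _ => Prod.ext hFH.u_inf hPG.l_sup,
    fun a b _ => ⟨hPG.le_u_l a, hFH.l_u_le b⟩,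
    fun a b _ => ⟨hFH.le_u_l a, hPG.l_u_le b⟩,
    fun a b x y _ _ => ⟨L.T4G a x, L.F_inf_G_le b y⟩,
    fun a b x y _ _ => ⟨L.T4H a x, L.P_inf_H_le b y⟩,
    fun a b x y _ _ => ⟨L.G_imp_inf_imp_le_G_F a b x y, L.T3G a y⟩,
    fun a b x y _ _ => ⟨L.H_imp_inf_imp_le_H_P a b x y, L.T3H a y⟩,
    fun a b x y _ _ => ⟨L.G_imp_inf_imp_le_F_G a b x y, L.F_inf_G_le a y⟩,
    fun a b x y _ _ => ⟨L.H_imp_inf_imp_le_P_H a b x y, L.P_inf_H_le a y⟩,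
    fun hG hH => ⟨Prod.ext hG hFH.l_bot, Prod.ext hH hPG.l_bot⟩⟩
end

section
/- Let U = (T, G, H) be a tense centered KI-algebra. Then the map β(x) = (x ⊔ c, ∼x ⊔ c) commutes with the tense operators, i.e., for all x ∈ T: G x ⊔ c = G(x ⊔ c) and ∼(G x) ⊔ c = F(∼x ⊔ c), and H x ⊔ c = H(x ⊔ c) and ∼(H x) ⊔ c = P(∼x ⊔ c); equivalently β(G x) = (G(x⊔c), F(∼x⊔c)) and β(H x) = (H(x⊔c), P(∼x⊔c)). -/
namespace TenseKI

variable {T : Type*} [DistribLattice T] [BoundedOrder T] (K : TenseKI T)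

theorem neg_neg_sup_c (x : T) : K.neg (K.neg x ⊔ K.c) = x ⊓ K.c := by
  rw [K.neg_sup, K.neg_neg, K.neg_c]

/-- A meet-preserving operator that fixes `c` and satisfies the tense join inequality
commutes with joining `c`. -/
theorem sup_c_eq {N : T → T} (hinf : ∀ x y, N (x ⊓ y) = N x ⊓ N y)
    (hsup : ∀ x y, N (x ⊔ y) ≤ N x ⊔ K.neg (N (K.neg y))) (hc : N K.c = K.c) (x : T) :
    N x ⊔ K.c = N (x ⊔ K.c) := by
  have mono {a b : T} (hab : a ≤ b) : N a ≤ N b :=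
    inf_eq_left.mp (by rw [← hinf, inf_eq_left.mpr hab])
  apply le_antisymm
  · exact sup_le (mono le_sup_left) (hc.ge.trans (mono le_sup_right))
  · simpa only [K.neg_c, hc] using hsup x K.c

/-- The dual of a meet-preserving operator that fixes `c` commutes with joining `c`. -/
theorem neg_sup_c_eq {N : T → T} (hinf : ∀ x y, N (x ⊓ y) = N x ⊓ N y)
    (hc : N K.c = K.c) (x : T) :
    K.neg (N x) ⊔ K.c = K.neg (N (K.neg (K.neg x ⊔ K.c))) := by
  rw [K.neg_neg_sup_c, hinf, hc, K.neg_inf, K.neg_c]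

end TenseKI

/-- The map β(x) = (x ⊔ c, ∼x ⊔ c) commutes with the tense operators of a
tense centered KI-algebra. -/
theorem stmt7 {T : Type*} [DistribLattice T] [BoundedOrder T] (K : TenseKI T)
    (hGc : K.G K.c = K.c) (hHc : K.H K.c = K.c) :
    ∀ x : T,
      (K.G x ⊔ K.c = K.G (x ⊔ K.c) ∧ K.neg (K.G x) ⊔ K.c = K.F (K.neg x ⊔ K.c)) ∧
      (K.H x ⊔ K.c = K.H (x ⊔ K.c) ∧ K.neg (K.H x) ⊔ K.c = K.P (K.neg x ⊔ K.c)) ∧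
      (K.G x ⊔ K.c, K.neg (K.G x) ⊔ K.c) = (K.G (x ⊔ K.c), K.F (K.neg x ⊔ K.c)) ∧
      (K.H x ⊔ K.c, K.neg (K.H x) ⊔ K.c) = (K.H (x ⊔ K.c), K.P (K.neg x ⊔ K.c)) := by
  intro x
  have hG := K.sup_c_eq K.t2G K.t4G hGc x
  have hH := K.sup_c_eq K.t2H K.t4H hHc x
  have hF : K.neg (K.G x) ⊔ K.c = K.F (K.neg x ⊔ K.c) := K.neg_sup_c_eq K.t2G hGc x
  have hP : K.neg (K.H x) ⊔ K.c = K.P (K.neg x ⊔ K.c) := K.neg_sup_c_eq K.t2H hHc x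
  exact ⟨⟨hG, hF⟩, ⟨hH, hP⟩, Prod.ext hG hF, Prod.ext hH hP⟩
end

section
/- Let L be a tense DLI₀₁⁺-algebra. Then the assignments S ↦ Θ(S) := {(a,b) : a→b ∈ S and b→a ∈ S} and θ ↦ ⊤/θ := {a : (a,⊤) ∈ θ} are mutually inverse bijections between the set of tense 1-filters of L and the set of congruences of L (equivalence relations compatible with ⊓, ⊔, →, G, H, F, P). -/
section

variable {A : Type*} [DistribLattice A] [BoundedOrder A]

/-- A tense 1-filter: a lattice filter S (nonempty, upward closed, closed
under ⊓) with ((a⊓f)→b)→(a→b) ∈ S for all a, b and f ∈ S, closed under G, H. -/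
def IsTense1Filter (L : TenseDLIp A) (S : Set A) : Prop :=
  S.Nonempty ∧
  (∀ x ∈ S, ∀ y : A, x ≤ y → y ∈ S) ∧
  (∀ x ∈ S, ∀ y ∈ S, x ⊓ y ∈ S) ∧
  (∀ a b : A, ∀ f ∈ S, L.imp (L.imp (a ⊓ f) b) (L.imp a b) ∈ S) ∧
  (∀ x ∈ S, L.G x ∈ S) ∧ (∀ x ∈ S, L.H x ∈ S)

/-- A congruence of a tense DLI⁺-algebra: an equivalence relation compatible
with ⊓, ⊔, →, G, H, F, P. -/
def IsCongr (L : TenseDLIp A) (θ : A → A → Prop) : Prop :=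
  Equivalence θ ∧
  (∀ a b x y : A, θ a b → θ x y →
    θ (a ⊓ x) (b ⊓ y) ∧ θ (a ⊔ x) (b ⊔ y) ∧ θ (L.imp a x) (L.imp b y)) ∧
  (∀ a b : A, θ a b →
    θ (L.G a) (L.G b) ∧ θ (L.H a) (L.H b) ∧ θ (L.F a) (L.F b) ∧ θ (L.P a) (L.P b))

/-- Θ(S) = {(a,b) : a→b ∈ S and b→a ∈ S}. -/
def Theta (L : TenseDLIp A) (S : Set A) : A → A → Prop :=
  fun a b => L.imp a b ∈ S ∧ L.imp b a ∈ S

/-- ⊤/θ = {a : (a,⊤) ∈ θ}. -/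
def topClass (θ : A → A → Prop) : Set A := {a | θ a ⊤}

end

section

variable {A : Type*} [DistribLattice A] [BoundedOrder A]

namespace TenseDLIp

variable (L : TenseDLIp A)

lemma imp_mono_right {x y : A} (a : A) (h : x ≤ y) : L.imp a x ≤ L.imp a y := by
  rw [← inf_eq_left, L.I1, inf_eq_left.mpr h]

lemma imp_anti_left {x y : A} (a : A) (h : x ≤ y) : L.imp y a ≤ L.imp x a := by
  rw [← inf_eq_left, L.I2, sup_eq_left.mpr h]

lemma imp_eq_top_of_le (h1 : ∀ x : A, L.imp x x = ⊤) {x y : A} (h : x ≤ y) :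
    L.imp x y = ⊤ :=
  top_le_iff.mp ((h1 x).ge.trans (L.imp_mono_right x h))

lemma G_top : L.G ⊤ = ⊤ := top_le_iff.mp ((L.T1 _ _).mp le_top)

lemma H_top : L.H ⊤ = ⊤ := top_le_iff.mp ((L.T2 _ _).mp le_top)

end TenseDLIp

namespace IsTense1Filter

variable {L : TenseDLIp A} {S : Set A}

lemma top_mem (hS : IsTense1Filter L S) : ⊤ ∈ S :=
  hS.1.elim fun x hx => hS.2.1 x hx ⊤ le_top

lemma imp_mem_iff (hS : IsTense1Filter L S) (h1 : ∀ x : A, L.imp x x = ⊤) {a b : A} :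
    L.imp a b ∈ S ↔ ∃ f ∈ S, a ⊓ f ≤ b := by
  refine ⟨fun h => ⟨_, h, L.I5 a b⟩, fun ⟨f, hf, hle⟩ => ?_⟩
  have h := hS.2.2.2.1 a b f hf
  rw [L.imp_eq_top_of_le h1 hle] at h
  exact hS.2.1 _ h _ (by simpa using L.I5 ⊤ (L.imp a b))

lemma imp_trans_mem (hS : IsTense1Filter L S) (h1 : ∀ x : A, L.imp x x = ⊤) {a b c : A}
    (hab : L.imp a b ∈ S) (hbc : L.imp b c ∈ S) : L.imp a c ∈ S := by
  refine (hS.imp_mem_iff h1).mpr ⟨_, hS.2.2.1 _ hab _ hbc, ?_⟩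
  rw [← inf_assoc]
  exact (inf_le_inf_right _ (L.I5 a b)).trans (L.I5 b c)

lemma inf_imp_inf_mem (hS : IsTense1Filter L S) (h1 : ∀ x : A, L.imp x x = ⊤) {a b x y : A}
    (hab : L.imp a b ∈ S) (hxy : L.imp x y ∈ S) : L.imp (a ⊓ x) (b ⊓ y) ∈ S := by
  refine (hS.imp_mem_iff h1).mpr ⟨_, hS.2.2.1 _ hab _ hxy, ?_⟩
  rw [inf_inf_inf_comm]
  exact inf_le_inf (L.I5 a b) (L.I5 x y)

lemma sup_imp_sup_mem (hS : IsTense1Filter L S) (h1 : ∀ x : A, L.imp x x = ⊤) {a b x y : A}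
    (hab : L.imp a b ∈ S) (hxy : L.imp x y ∈ S) : L.imp (a ⊔ x) (b ⊔ y) ∈ S := by
  refine (hS.imp_mem_iff h1).mpr ⟨_, hS.2.2.1 _ hab _ hxy, ?_⟩
  rw [inf_sup_right]
  exact sup_le_sup ((inf_le_inf_left _ inf_le_left).trans (L.I5 a b))
    ((inf_le_inf_left _ inf_le_right).trans (L.I5 x y))

lemma imp_imp_imp_mem_left (hS : IsTense1Filter L S) {a b : A} (x : A)
    (hba : L.imp b a ∈ S) : L.imp (L.imp a x) (L.imp b x) ∈ S :=
  hS.2.1 _ (hS.2.2.2.1 b x _ hba) _ (L.imp_anti_left _ (L.imp_anti_left _ (L.I5 b a)))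

lemma imp_imp_imp_mem_right (hS : IsTense1Filter L S) (h1 : ∀ x : A, L.imp x x = ⊤) (a : A)
    {x y : A} (hxy : L.imp x y ∈ S) : L.imp (L.imp a x) (L.imp a y) ∈ S := by
  refine hS.2.1 _ (hS.2.2.2.1 a y _ hxy) _ (L.imp_anti_left _ ?_)
  calc L.imp a x ≤ L.imp (a ⊓ L.imp x y) x := L.imp_anti_left _ inf_le_left
    _ = L.imp (a ⊓ L.imp x y) (x ⊓ L.imp x y) := by
      rw [← L.I1, L.imp_eq_top_of_le h1 (y := L.imp x y) inf_le_right, inf_top_eq]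
    _ ≤ L.imp (a ⊓ L.imp x y) y := L.imp_mono_right _ (L.I5 x y)

lemma imp_imp_imp_mem (hS : IsTense1Filter L S) (h1 : ∀ x : A, L.imp x x = ⊤) {a b x y : A}
    (hba : L.imp b a ∈ S) (hxy : L.imp x y ∈ S) : L.imp (L.imp a x) (L.imp b y) ∈ S :=
  hS.imp_trans_mem h1 (hS.imp_imp_imp_mem_left x hba) (hS.imp_imp_imp_mem_right h1 b hxy)

lemma isCongr_theta (hS : IsTense1Filter L S) (h1 : ∀ x : A, L.imp x x = ⊤) :
    IsCongr L (Theta L S) := by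
  have hup := hS.2.1
  have hG := hS.2.2.2.2.1
  have hH := hS.2.2.2.2.2
  refine ⟨⟨fun a => ?_, fun h => ⟨h.2, h.1⟩, fun h k =>
    ⟨hS.imp_trans_mem h1 h.1 k.1, hS.imp_trans_mem h1 k.2 h.2⟩⟩,
    fun a b x y h k => ⟨?_, ?_, ?_⟩, fun a b h => ⟨?_, ?_, ?_, ?_⟩⟩
  · simpa only [Theta, h1, and_self] using hS.top_mem
  · exact ⟨hS.inf_imp_inf_mem h1 h.1 k.1, hS.inf_imp_inf_mem h1 h.2 k.2⟩
  · exact ⟨hS.sup_imp_sup_mem h1 h.1 k.1, hS.sup_imp_sup_mem h1 h.2 k.2⟩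
  · exact ⟨hS.imp_imp_imp_mem h1 h.2 k.1, hS.imp_imp_imp_mem h1 h.1 k.2⟩
  · exact ⟨hup _ (hG _ h.1) _ (L.T5G a b), hup _ (hG _ h.2) _ (L.T5G b a)⟩
  · exact ⟨hup _ (hH _ h.1) _ (L.T5H a b), hup _ (hH _ h.2) _ (L.T5H b a)⟩
  · exact ⟨hup _ (hG _ h.1) _ (L.T6G a b), hup _ (hG _ h.2) _ (L.T6G b a)⟩
  · exact ⟨hup _ (hH _ h.1) _ (L.T6H a b), hup _ (hH _ h.2) _ (L.T6H b a)⟩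

lemma topClass_theta (hS : IsTense1Filter L S) (h1 : ∀ x : A, L.imp x x = ⊤) :
    topClass (Theta L S) = S := by
  ext a
  change L.imp a ⊤ ∈ S ∧ L.imp ⊤ a ∈ S ↔ a ∈ S
  rw [L.I4, hS.imp_mem_iff h1]
  simp only [top_inf_eq]
  exact ⟨fun ⟨_, f, hf, hfa⟩ => hS.2.1 f hf a hfa, fun ha => ⟨hS.top_mem, a, ha, le_rfl⟩⟩

end IsTense1Filter

namespace IsCongr

variable {L : TenseDLIp A} {θ : A → A → Prop}

lemma isTense1Filter_topClass (hθ : IsCongr L θ) (h1 : ∀ x : A, L.imp x x = ⊤) :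
    IsTense1Filter L (topClass θ) := by
  obtain ⟨he, hbin, hun⟩ := hθ
  refine ⟨⟨⊤, he.refl ⊤⟩, fun x hx y hxy => ?_, fun x hx y hy => ?_, fun a b f hf => ?_,
    fun x hx => ?_, fun x hx => ?_⟩
  · simpa [topClass, hxy] using (hbin x ⊤ y y hx (he.refl y)).2.1
  · simpa [topClass] using (hbin x ⊤ y ⊤ hx hy).1
  · have haf : θ (a ⊓ f) a := by simpa using (hbin a a f ⊤ (he.refl a) hf).1
    have himp := (hbin _ _ b b haf (he.refl b)).2.2
    simpa [topClass, h1] using (hbin _ _ _ _ himp (he.refl (L.imp a b))).2.2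
  · simpa [topClass, L.G_top] using (hun x ⊤ hx).1
  · simpa [topClass, L.H_top] using (hun x ⊤ hx).2.1

lemma rel_inf_of_imp_mem_topClass (hθ : IsCongr L θ) {a b : A}
    (h : L.imp a b ∈ topClass θ) : θ a (a ⊓ b) := by
  obtain ⟨he, hbin, -⟩ := hθ
  have ha : θ (a ⊓ L.imp a b) a := by simpa using (hbin a a _ ⊤ (he.refl a) h).1
  have hb := (hbin _ _ b b ha (he.refl b)).1
  rw [inf_eq_left.mpr (L.I5 a b)] at hb
  exact he.trans (he.symm ha) hb

lemma theta_topClass (hθ : IsCongr L θ) (h1 : ∀ x : A, L.imp x x = ⊤) :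
    Theta L (topClass θ) = θ := by
  have imp_mem {a b : A} (h : θ a b) : L.imp a b ∈ topClass θ := by
    simpa [topClass, h1] using (hθ.2.1 a b b b h (hθ.1.refl b)).2.2
  ext a b
  refine ⟨fun ⟨hab, hba⟩ => ?_, fun h => ⟨imp_mem h, imp_mem (hθ.1.symm h)⟩⟩
  have hb := hθ.rel_inf_of_imp_mem_topClass hba
  rw [inf_comm] at hb
  exact hθ.1.trans (hθ.rel_inf_of_imp_mem_topClass hab) (hθ.1.symm hb)

end IsCongr

end

/-- In a tense DLI₀₁⁺-algebra, S ↦ Θ(S) and θ ↦ ⊤/θ are mutually inverse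
bijections between tense 1-filters and congruences. -/
theorem stmt9 {A : Type*} [DistribLattice A] [BoundedOrder A] (L : TenseDLIp A)
    (hG0 : L.G ⊥ = ⊥) (hH0 : L.H ⊥ = ⊥) (h1 : ∀ x : A, L.imp x x = ⊤) :
    (∀ S : Set A, IsTense1Filter L S → IsCongr L (Theta L S)) ∧
    (∀ θ : A → A → Prop, IsCongr L θ → IsTense1Filter L (topClass θ)) ∧
    (∀ S : Set A, IsTense1Filter L S → topClass (Theta L S) = S) ∧
    (∀ θ : A → A → Prop, IsCongr L θ → Theta L (topClass θ) = θ) := by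
  exact ⟨fun _ hS => hS.isCongr_theta h1, fun _ hθ => hθ.isTense1Filter_topClass h1,
    fun _ hS => hS.topClass_theta h1, fun _ hθ => hθ.theta_topClass h1⟩
end

section
/- Let L be a tense DLI⁺-algebra with G⊥ = ⊥ and H⊥ = ⊥. If θ is a congruence of L (compatible with ⊓, ⊔, →, G, H, F, P), then the relation γ_θ on K(A) defined by (a,b) γ_θ (x,y) iff (a,x) ∈ θ and (b,y) ∈ θ is a congruence of K(L) (compatible with ⊓, ⊔, ⇒, ∼, G_K, H_K). Conversely, if γ is a congruence of K(L), then the relation θ^γ on A defined by (a,b) ∈ θ^γ iff (a,⊥) γ (b,⊥) is a congruence of L. -/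
section

variable {A : Type*} [DistribLattice A] [BoundedOrder A]

/-- Membership in the Kalman construction K(A). -/
def memK (p : A × A) : Prop := p.1 ⊓ p.2 = ⊥

/-- A congruence of the Kalman construction K(L): an equivalence relation on
K(A) compatible with ⊓, ⊔, ⇒, ∼, G_K, H_K. -/
def IsCongrK (L : TenseDLIp A) (γ : A × A → A × A → Prop) : Prop :=
  (∀ p : A × A, memK p → γ p p) ∧
  (∀ p q : A × A, memK p → memK q → γ p q → γ q p) ∧
  (∀ p q r : A × A, memK p → memK q → memK r → γ p q → γ q r → γ p r) ∧
  (∀ p q r s : A × A, memK p → memK q → memK r → memK s → γ p q → γ r s →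
    γ (infK p r) (infK q s) ∧ γ (supK p r) (supK q s) ∧
    γ (impK L p r) (impK L q s)) ∧
  (∀ p q : A × A, memK p → memK q → γ p q →
    γ (negK p) (negK q) ∧ γ (GK L p) (GK L q) ∧ γ (HK L p) (HK L q))

/-- The congruence γ_θ on K(A) induced by a congruence θ. -/
def gammaOf (θ : A → A → Prop) : A × A → A × A → Prop :=
  fun p q => θ p.1 q.1 ∧ θ p.2 q.2

/-- The congruence θ^γ on A induced by a congruence γ of K(L). -/
def thetaOf (γ : A × A → A × A → Prop) : A → A → Prop :=
  fun a b => γ (a, ⊥) (b, ⊥)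

end

section

variable {A : Type*} [DistribLattice A] [BoundedOrder A]

theorem TenseDLIp.F_bot_s10 (L : TenseDLIp A) : L.F ⊥ = ⊥ :=
  le_bot_iff.1 ((L.T2 ⊥ ⊥).2 bot_le)

theorem TenseDLIp.P_bot_s10 (L : TenseDLIp A) : L.P ⊥ = ⊥ :=
  le_bot_iff.1 ((L.T1 ⊥ ⊥).2 bot_le)

theorem memK_left (a : A) : memK (a, (⊥ : A)) := inf_bot_eq a

theorem memK_right (a : A) : memK ((⊥ : A), a) := bot_inf_eq a

theorem IsCongr.isCongrK_gammaOf {L : TenseDLIp A} {θ : A → A → Prop} (h : IsCongr L θ) :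
    IsCongrK L (gammaOf θ) := by
  obtain ⟨he, hb, hu⟩ := h
  refine ⟨fun p _ => ⟨he.refl _, he.refl _⟩, fun p q _ _ h => ⟨he.symm h.1, he.symm h.2⟩,
    fun p q r _ _ _ h k => ⟨he.trans h.1 k.1, he.trans h.2 k.2⟩, ?_, ?_⟩
  · rintro p q r s - - - - ⟨h₁, h₂⟩ ⟨k₁, k₂⟩
    exact ⟨⟨(hb _ _ _ _ h₁ k₁).1, (hb _ _ _ _ h₂ k₂).2.1⟩,
      ⟨(hb _ _ _ _ h₁ k₁).2.1, (hb _ _ _ _ h₂ k₂).1⟩,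
      (hb _ _ _ _ (hb _ _ _ _ h₁ k₁).2.2 (hb _ _ _ _ k₂ h₂).2.2).1,
      (hb _ _ _ _ h₁ k₂).1⟩
  · rintro p q - - ⟨h₁, h₂⟩
    exact ⟨⟨h₂, h₁⟩, ⟨(hu _ _ h₁).1, (hu _ _ h₂).2.2.1⟩, (hu _ _ h₁).2.1, (hu _ _ h₂).2.2.2⟩

theorem IsCongrK.isCongr_thetaOf {L : TenseDLIp A} (hG0 : L.G ⊥ = ⊥) (hH0 : L.H ⊥ = ⊥)
    {γ : A × A → A × A → Prop} (h : IsCongrK L γ) : IsCongr L (thetaOf γ) := by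
  obtain ⟨hr, hs, ht, hb, hu⟩ := h
  refine ⟨⟨fun a => hr _ (memK_left a), fun h => hs _ _ (memK_left _) (memK_left _) h,
    fun h k => ht _ _ _ (memK_left _) (memK_left _) (memK_left _) h k⟩, ?_, ?_⟩
  · intro a b x y hab hxy
    simpa [thetaOf, infK, supK, impK, L.I3] using
      hb _ _ _ _ (memK_left a) (memK_left b) (memK_left x) (memK_left y) hab hxy
  · intro a b hab
    obtain ⟨hn, hG, hH⟩ := hu _ _ (memK_left a) (memK_left b) hab
    obtain ⟨-, hF, hP⟩ := hu _ _ (memK_right a) (memK_right b) hn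
    simp only [GK, HK, hG0, hH0, L.F_bot_s10, L.P_bot_s10] at hG hH hF hP
    exact ⟨hG, hH, (hu _ _ (memK_right _) (memK_right _) hF).1,
      (hu _ _ (memK_right _) (memK_right _) hP).1⟩

end

/-- If θ is a congruence of a tense DLI⁺-algebra L with G⊥ = ⊥ and H⊥ = ⊥,
then γ_θ is a congruence of K(L); conversely, if γ is a congruence of K(L)
then θ^γ is a congruence of L. -/
theorem stmt10 {A : Type*} [DistribLattice A] [BoundedOrder A] (L : TenseDLIp A)
    (hG0 : L.G ⊥ = ⊥) (hH0 : L.H ⊥ = ⊥) :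
    (∀ θ : A → A → Prop, IsCongr L θ → IsCongrK L (gammaOf θ)) ∧
    (∀ γ : A × A → A × A → Prop, IsCongrK L γ → IsCongr L (thetaOf γ)) :=
  ⟨fun _ h => h.isCongrK_gammaOf, fun _ h => h.isCongr_thetaOf hG0 hH0⟩
end

section
/- Let U = (T, G, H) be an itKI_c1-algebra and let D be a tense deductive system of U. Then S_D := D ∩ C(T) is a tense 1-filter of C(U) if and only if for every u, v ∈ D and a, b ∈ C(T): (tD4) (u ⊓ v) ⊔ c ∈ D, and (tD5) t(a, b, u ⊔ c) ∈ D, where t(x,y,z) := ((x⊓z)⇒y)⇒(x⇒y). -/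
/-- An itKI_c1-algebra: a tense centered KI-algebra satisfying x ⇒ x = ⊤
and the interpolation condition (CK). -/
structure ItKIc1 (T : Type*) [DistribLattice T] [BoundedOrder T] extends TenseKI T where
  Gc : G c = c
  Hc : H c = c
  imp_self : ∀ x : T, imp x x = ⊤
  CK : ∀ x y : T, c ≤ x → c ≤ y → x ⊓ y ≤ c → ∃ z : T, z ⊔ c = x ∧ neg z ⊔ c = y

section
variable {T : Type*} [DistribLattice T] [BoundedOrder T]

/-- F on an itKI_c1-algebra. -/
abbrev ItKIc1.F (K : ItKIc1 T) : T → T := K.toTenseKI.F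

/-- P on an itKI_c1-algebra. -/
abbrev ItKIc1.P (K : ItKIc1 T) : T → T := K.toTenseKI.P

/-- A congruence of an itKI_c1-algebra: an equivalence relation compatible
with ⊓, ⊔, ⇒, ∼, G, H. -/
def ItKIc1.IsCongrU (K : ItKIc1 T) (ε : T → T → Prop) : Prop :=
  Equivalence ε ∧
  (∀ a b x y : T, ε a b → ε x y →
    ε (a ⊓ x) (b ⊓ y) ∧ ε (a ⊔ x) (b ⊔ y) ∧ ε (K.imp a x) (K.imp b y)) ∧
  (∀ a b : T, ε a b → ε (K.neg a) (K.neg b) ∧ ε (K.G a) (K.G b) ∧ ε (K.H a) (K.H b))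

/-- A tense 1-filter of C(U): a lattice filter S of C(T) = {x : c ≤ x} with
((a⊓f)⇒b)⇒(a⇒b) ∈ S for all a, b ∈ C(T), f ∈ S, closed under G and H. -/
def ItKIc1.IsTense1FilterC (K : ItKIc1 T) (S : Set T) : Prop :=
  (∀ x ∈ S, K.c ≤ x) ∧ S.Nonempty ∧
  (∀ x ∈ S, ∀ y : T, K.c ≤ y → x ≤ y → y ∈ S) ∧
  (∀ x ∈ S, ∀ y ∈ S, x ⊓ y ∈ S) ∧
  (∀ a b : T, K.c ≤ a → K.c ≤ b → ∀ f ∈ S,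
    K.imp (K.imp (a ⊓ f) b) (K.imp a b) ∈ S) ∧
  (∀ x ∈ S, K.G x ∈ S) ∧ (∀ x ∈ S, K.H x ∈ S)

/-- A tense deductive system of U: contains ⊤, closed under modus ponens
and under G and H. -/
def ItKIc1.IsTDS (K : ItKIc1 T) (D : Set T) : Prop :=
  ⊤ ∈ D ∧ (∀ u ∈ D, ∀ v : T, K.imp u v ∈ D → v ∈ D) ∧
  (∀ u ∈ D, K.G u ∈ D ∧ K.H u ∈ D)

/-- A centered tense deductive system: a tense deductive system D such that
(ctD1) D ∩ C(T) is a tense 1-filter of C(U) and (ctD2) ∼u⇒c ∈ D and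
⊤⇒(u⊔c) ∈ D imply u ∈ D. -/
def ItKIc1.IsCTDS (K : ItKIc1 T) (D : Set T) : Prop :=
  K.IsTDS D ∧ K.IsTense1FilterC (D ∩ {x | K.c ≤ x}) ∧
  (∀ u : T, K.imp (K.neg u) K.c ∈ D → K.imp ⊤ (u ⊔ K.c) ∈ D → u ∈ D)

end

section
variable {T : Type*} [DistribLattice T] [BoundedOrder T]

namespace ItKIc1

theorem imp_eq_top_of_le (K : ItKIc1 T) {x y : T} (h : x ≤ y) : K.imp x y = ⊤ := by
  have key := K.KI1a x x y
  rw [inf_eq_left.mpr h, K.imp_self, top_inf_eq] at key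
  exact key

theorem c_le_imp (K : ItKIc1 T) (x : T) {y : T} (h : K.c ≤ y) : K.c ≤ K.imp x y := by
  have key := K.KI4 x y
  rw [inf_eq_right.mpr (h.trans le_sup_right)] at key
  exact inf_eq_right.mp key

theorem c_le_G (K : ItKIc1 T) {x : T} (h : K.c ≤ x) : K.c ≤ K.G x := by
  have key := K.t2G K.c x
  rw [inf_eq_left.mpr h, K.Gc] at key
  exact inf_eq_left.mp key.symm

theorem c_le_H (K : ItKIc1 T) {x : T} (h : K.c ≤ x) : K.c ≤ K.H x := by
  have key := K.t2H K.c x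
  rw [inf_eq_left.mpr h, K.Hc] at key
  exact inf_eq_left.mp key.symm

theorem IsTDS.mem_of_le {K : ItKIc1 T} {D : Set T} (hD : K.IsTDS D) {x y : T}
    (hx : x ∈ D) (h : x ≤ y) : y ∈ D :=
  hD.2.1 x hx y (by rw [K.imp_eq_top_of_le h]; exact hD.1)

end ItKIc1

end

/-- For a tense deductive system D of U, S_D = D ∩ C(T) is a tense 1-filter of
C(U) iff D satisfies (tD4) and (tD5), where t(x,y,z) = ((x⊓z)⇒y)⇒(x⇒y). -/
theorem stmt14 {T : Type*} [DistribLattice T] [BoundedOrder T] (K : ItKIc1 T)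
    (D : Set T) (hD : K.IsTDS D) :
    K.IsTense1FilterC (D ∩ {x | K.c ≤ x}) ↔
      ((∀ u ∈ D, ∀ v ∈ D, (u ⊓ v) ⊔ K.c ∈ D) ∧
       (∀ u ∈ D, ∀ a b : T, K.c ≤ a → K.c ≤ b →
         K.imp (K.imp (a ⊓ (u ⊔ K.c)) b) (K.imp a b) ∈ D)) := by
  constructor
  · rintro ⟨-, -, -, hinf, ht, -, -⟩
    have hsup : ∀ u ∈ D, u ⊔ K.c ∈ D ∩ {x | K.c ≤ x} := fun u hu =>
      ⟨hD.mem_of_le hu le_sup_left, le_sup_right⟩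
    refine ⟨fun u hu v hv => ?_, fun u hu a b ha hb => (ht a b ha hb _ (hsup u hu)).1⟩
    rw [sup_inf_right]
    exact (hinf _ (hsup u hu) _ (hsup v hv)).1
  · rintro ⟨h4, h5⟩
    refine ⟨fun x hx => hx.2, ⟨⊤, hD.1, le_top⟩, fun x hx y hy hxy => ⟨hD.mem_of_le hx.1 hxy, hy⟩,
      fun x hx y hy => ?_, fun a b ha hb f hf => ?_,
      fun x hx => ⟨(hD.2.2 x hx.1).1, K.c_le_G hx.2⟩,
      fun x hx => ⟨(hD.2.2 x hx.1).2, K.c_le_H hx.2⟩⟩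
    · have hc : K.c ≤ x ⊓ y := le_inf hx.2 hy.2
      have key := h4 x hx.1 y hy.1
      rw [sup_eq_left.mpr hc] at key
      exact ⟨key, hc⟩
    · have key := h5 f hf.1 a b ha hb
      rw [sup_eq_left.mpr hf.2] at key
      exact ⟨key, K.c_le_imp _ (K.c_le_imp _ hb)⟩
end

section
/- Let L be a DLI⁺-algebra satisfying x→x = ⊤ for all x. Then the residuation law holds (for all x, y, z: x ⊓ y ≤ z if and only if x ≤ y→z, i.e., → is a Heyting implication) if and only if x ≤ y→x for all x, y. -/
theorem DLI.imp_mono_right {A : Type*} [DistribLattice A] [BoundedOrder A] (D : DLI A)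
    (a : A) {b c : A} (hbc : b ≤ c) : D.imp a b ≤ D.imp a c := by
  rw [← inf_eq_left, D.I1, inf_eq_left.mpr hbc]

/-- In a DLI⁺-algebra with x→x = ⊤, the implication is a Heyting implication
(residuation holds) iff x ≤ y→x for all x, y. -/
theorem stmt18 {A : Type*} [DistribLattice A] [BoundedOrder A] (D : DLI A)
    (hI5 : ∀ a b : A, a ⊓ D.imp a b ≤ b) (h1 : ∀ x : A, D.imp x x = ⊤) :
    (∀ x y z : A, x ⊓ y ≤ z ↔ x ≤ D.imp y z) ↔ (∀ x y : A, x ≤ D.imp y x) := by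
  constructor
  · exact fun h x y => (h x y x).mp inf_le_left
  · refine fun h x y z => ⟨fun hxyz => ?_, fun hx => ?_⟩
    · calc
        x ≤ D.imp y x := h x y
        _ = D.imp y (x ⊓ y) := by rw [← D.I1, h1, inf_top_eq]
        _ ≤ D.imp y z := D.imp_mono_right y hxyz
    · calc
        x ⊓ y ≤ D.imp y z ⊓ y := inf_le_inf_right y hx
        _ = y ⊓ D.imp y z := inf_comm _ _
        _ ≤ z := hI5 y z
end

section
/- Let A be a Heyting algebra (with Heyting implication ⇨) and let G, H, F, P be unary operations on A satisfying (T0) G⊥ = ⊥ and H⊥ = ⊥, (T1) P x ≤ y ⟺ x ≤ G y, (T2) F x ≤ y ⟺ x ≤ H y, (T3) G x ⊓ F y ≤ F(x⊓y) and H x ⊓ P y ≤ P(x⊓y), (T4) G(x⊔y) ≤ G x ⊔ F y and H(x⊔y) ≤ H x ⊔ P y. Then (T5) G(x ⇨ y) ≤ G x ⇨ G y and H(x ⇨ y) ≤ H x ⇨ H y, and (T6) G(x ⇨ y) ≤ F x ⇨ F y and H(x ⇨ y) ≤ P x ⇨ P y; hence (A, G, H, F, P) is a tense DLI₀₁⁺-algebra.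 -/
/-- An upper adjoint between Heyting algebras is subdistributive over implication. -/
theorem GaloisConnection.u_himp_le {A B : Type*} [HeytingAlgebra A] [HeytingAlgebra B]
    {l : A → B} {u : B → A} (gc : GaloisConnection l u) (x y : B) :
    u (x ⇨ y) ≤ u x ⇨ u y := by
  rw [le_himp_iff, ← gc.u_inf]
  exact gc.monotone_u himp_inf_le

/-- If `g x ⊓ f y ≤ f (x ⊓ y)` and `f` is monotone, then `g (x ⇨ y) ≤ f x ⇨ f y`. -/
theorem Monotone.le_himp_of_inf_le {A B : Type*} [HeytingAlgebra A] [HeytingAlgebra B]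
    {f g : A → B} (hf : Monotone f) (h : ∀ x y, g x ⊓ f y ≤ f (x ⊓ y)) (x y : A) :
    g (x ⇨ y) ≤ f x ⇨ f y := by
  rw [le_himp_iff]
  exact (h _ _).trans (hf himp_inf_le)

/-- A Heyting algebra with operations G, H, F, P satisfying (T0)-(T4) also
satisfies (T5) and (T6); hence it is a tense DLI₀₁⁺-algebra. -/
theorem stmt19 {A : Type*} [HeytingAlgebra A]
    (G H F P : A → A)
    (hT0G : G ⊥ = ⊥) (hT0H : H ⊥ = ⊥)
    (hT1 : ∀ x y : A, P x ≤ y ↔ x ≤ G y)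
    (hT2 : ∀ x y : A, F x ≤ y ↔ x ≤ H y)
    (hT3G : ∀ x y : A, G x ⊓ F y ≤ F (x ⊓ y))
    (hT3H : ∀ x y : A, H x ⊓ P y ≤ P (x ⊓ y))
    (hT4G : ∀ x y : A, G (x ⊔ y) ≤ G x ⊔ F y)
    (hT4H : ∀ x y : A, H (x ⊔ y) ≤ H x ⊔ P y) :
    (∀ x y : A, G (x ⇨ y) ≤ G x ⇨ G y) ∧ (∀ x y : A, H (x ⇨ y) ≤ H x ⇨ H y) ∧
    (∀ x y : A, G (x ⇨ y) ≤ F x ⇨ F y) ∧ (∀ x y : A, H (x ⇨ y) ≤ P x ⇨ P y) ∧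
    (∃ L : TenseDLIp A,
      L.imp = (fun x y : A => x ⇨ y) ∧ L.G = G ∧ L.H = H ∧ L.F = F ∧ L.P = P ∧
      L.G ⊥ = ⊥ ∧ L.H ⊥ = ⊥ ∧ (∀ x : A, L.imp x x = ⊤)) := by
  have gcG : GaloisConnection P G := hT1
  have gcH : GaloisConnection F H := hT2
  have hT5G := gcG.u_himp_le
  have hT5H := gcH.u_himp_le
  have hT6G := gcH.monotone_l.le_himp_of_inf_le hT3G
  have hT6H := gcG.monotone_l.le_himp_of_inf_le hT3H
  refine ⟨hT5G, hT5H, hT6G, hT6H, ?_⟩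
  exact ⟨{ imp := fun x y => x ⇨ y
           I1 := fun a b d => (himp_inf_distrib a b d).symm
           I2 := fun a b d => (sup_himp_distrib a b d).symm
           I3 := fun _ => bot_himp _
           I4 := fun _ => himp_top
           I5 := fun _ _ => inf_himp_le
           G := G
           H := H
           F := F
           P := P
           T1 := hT1
           T2 := hT2
           T3G := hT3G
           T3H := hT3H
           T4G := hT4G
           T4H := hT4H
           T5G := hT5G
           T5H := hT5H
           T6G := hT6G
           T6H := hT6H },
    rfl, rfl, rfl, rfl, rfl, hT0G, hT0H, fun _ => himp_self⟩
end
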